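/- arXiv:2604.22362 — 2 statements merged into one kernel-verified Lean document; each statement's English description precedes it below -/
import Mathlib

section
/- Let (X,d,τ) be a timed-metric space such that the null distance d̂_{d,τ} only takes finite values. Then (X, d̂_{d,τ}, τ) is a timed-metric space, and the null distance of (X, d̂_{d,τ}, τ) coincides with d̂_{d,τ}, i.e. d̂_{d̂_{d,τ},τ} = d̂_{d,τ}. In particular (X, d̂_{d,τ}, τ) is causally null. -/
open scoped ENNReal

/-- `p` is in the causal future of `q` w.r.t. the distance function `d`
(written `p ∈ J⁺(q)`) iff `τ p - τ q = d q p`. -/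
def causalFutureD {X : Type*} (d : X → X → ℝ) (τ : X → ℝ) (q p : X) : Prop :=
  τ p - τ q = d q p

/-- `p` and `q` are causally related (w.r.t. `d`, `τ`). -/
def causallyRelatedD {X : Type*} (d : X → X → ℝ) (τ : X → ℝ) (p q : X) : Prop :=
  causalFutureD d τ q p ∨ causalFutureD d τ p q

/-- The null distance `d̂_{d,τ}(x,y) ∈ [0,∞]`: the infimum of `∑ |τ(pᵢ) - τ(pᵢ₋₁)|` over
all finite chains `x = p₀, p₁, …, p_N = y` with consecutive points causally related;
`∞` (the infimum of the empty set) if no such chain exists. -/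
noncomputable def nullDistD {X : Type*} (d : X → X → ℝ) (τ : X → ℝ) (x y : X) : ℝ≥0∞ :=
  sInf { v | ∃ (N : ℕ) (p : ℕ → X), p 0 = x ∧ p N = y ∧
      (∀ i < N, causallyRelatedD d τ (p i) (p (i + 1))) ∧
      v = ENNReal.ofReal (∑ i ∈ Finset.range N, |τ (p (i + 1)) - τ (p i)|) }

theorem causallyRelatedD.symm {X : Type*} {d : X → X → ℝ} {τ : X → ℝ} {x y : X}
    (h : causallyRelatedD d τ x y) : causallyRelatedD d τ y x :=
  Or.symm h

/-- A potential that drops by at most `|τ y - τ x|` along every causal relation drops by at most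
the null distance. -/
theorem le_nullDistD_add {X : Type*} {d : X → X → ℝ} {τ : X → ℝ} (F : X → ℝ≥0∞)
    (hF : ∀ x y, causallyRelatedD d τ x y → F x ≤ ENNReal.ofReal |τ y - τ x| + F y) (x y : X) :
    F x ≤ nullDistD d τ x y + F y := by
  rw [← tsub_le_iff_right]
  refine le_sInf ?_
  rintro v ⟨N, p, rfl, rfl, hp, rfl⟩
  rw [tsub_le_iff_right]
  induction N with
  | zero => simp
  | succ N ih =>
    rw [Finset.sum_range_succ, ENNReal.ofReal_add (Finset.sum_nonneg fun _ _ => abs_nonneg _)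
      (abs_nonneg _), add_assoc]
    exact (ih fun i hi => hp i (by lia)).trans
      (add_le_add_right (hF _ _ (hp N (by lia))) _)

theorem nullDistD_self {X : Type*} (d : X → X → ℝ) (τ : X → ℝ) (x : X) :
    nullDistD d τ x x = 0 :=
  le_antisymm (sInf_le ⟨0, fun _ => x, rfl, rfl, by simp, by simp⟩) bot_le

theorem nullDistD_le_add_of_causallyRelatedD {X : Type*} {d : X → X → ℝ} {τ : X → ℝ} {x y : X}
    (h : causallyRelatedD d τ x y) (z : X) :
    nullDistD d τ x z ≤ ENNReal.ofReal |τ y - τ x| + nullDistD d τ y z := by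
  rw [← tsub_le_iff_left]
  refine le_sInf ?_
  rintro v ⟨N, p, rfl, rfl, hp, rfl⟩
  rw [tsub_le_iff_left, ← ENNReal.ofReal_add (abs_nonneg _)
    (Finset.sum_nonneg fun _ _ => abs_nonneg _)]
  refine sInf_le ⟨N + 1, fun i => Nat.casesOn i x p, rfl, rfl, ?_, ?_⟩
  · rintro (_ | i) hi
    · exact h
    · exact hp i (by lia)
  · rw [Finset.sum_range_succ', add_comm]
    rfl

theorem nullDistD_triangle {X : Type*} (d : X → X → ℝ) (τ : X → ℝ) (x y z : X) :
    nullDistD d τ x z ≤ nullDistD d τ x y + nullDistD d τ y z :=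
  le_nullDistD_add (fun w => nullDistD d τ w z)
    (fun _ _ h => nullDistD_le_add_of_causallyRelatedD h z) x y

theorem nullDistD_le_of_causallyRelatedD {X : Type*} {d : X → X → ℝ} {τ : X → ℝ} {x y : X}
    (h : causallyRelatedD d τ x y) : nullDistD d τ x y ≤ ENNReal.ofReal |τ y - τ x| := by
  simpa [nullDistD_self] using nullDistD_le_add_of_causallyRelatedD h y

theorem nullDistD_comm {X : Type*} (d : X → X → ℝ) (τ : X → ℝ) (x y : X) :
    nullDistD d τ x y = nullDistD d τ y x := by
  have key : ∀ x y, nullDistD d τ y x ≤ nullDistD d τ x y := fun x y => by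
    have := le_nullDistD_add (d := d) (τ := τ) (fun w => nullDistD d τ y w) (fun a b h => ?_) x y
    · simpa [nullDistD_self] using this
    · have hba := nullDistD_le_of_causallyRelatedD h.symm
      rw [abs_sub_comm] at hba
      exact (nullDistD_triangle d τ y b a).trans
        ((add_comm _ _).trans_le (add_le_add_left hba _))
  exact le_antisymm (key y x) (key x y)

theorem ofReal_abs_sub_le_nullDistD {X : Type*} (d : X → X → ℝ) (τ : X → ℝ) (x y : X) :
    ENNReal.ofReal |τ x - τ y| ≤ nullDistD d τ x y := by
  have := le_nullDistD_add (d := d) (τ := τ) (fun w => ENNReal.ofReal |τ w - τ y|)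
    (fun a b _ => ?_) x y
  · simpa using this
  · rw [← ENNReal.ofReal_add (abs_nonneg _) (abs_nonneg _), abs_sub_comm (τ b) (τ a)]
    exact ENNReal.ofReal_le_ofReal (abs_sub_le _ _ _)

theorem causallyRelatedD.le_abs_sub {X : Type*} {d : X → X → ℝ} {τ : X → ℝ}
    (hd : ∀ x y, d x y = d y x) {x y : X} (h : causallyRelatedD d τ x y) :
    d x y ≤ |τ y - τ x| := by
  rcases h with h | h <;> unfold causalFutureD at h
  · rw [hd, ← h, abs_sub_comm]
    exact le_abs_self _
  · rw [← h]
    exact le_abs_self _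

theorem edist_le_nullDistD {X : Type*} [PseudoMetricSpace X] (τ : X → ℝ) (x y : X) :
    edist x y ≤ nullDistD dist τ x y := by
  have := le_nullDistD_add (d := dist) (τ := τ) (fun w => edist w y) (fun a b h => ?_) x y
  · simpa using this
  · refine (edist_triangle a b y).trans (add_le_add_left ?_ _)
    rw [edist_dist]
    exact ENNReal.ofReal_le_ofReal (h.le_abs_sub dist_comm)

theorem causallyRelatedD.toReal_nullDistD {X : Type*} {d : X → X → ℝ} {τ : X → ℝ} {x y : X}
    (h : causallyRelatedD d τ x y) :
    causallyRelatedD (fun x y => (nullDistD d τ x y).toReal) τ x y := by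
  have hxy : nullDistD d τ x y = ENNReal.ofReal |τ y - τ x| :=
    le_antisymm (nullDistD_le_of_causallyRelatedD h)
      (abs_sub_comm (τ x) (τ y) ▸ ofReal_abs_sub_le_nullDistD d τ x y)
  unfold causallyRelatedD causalFutureD
  beta_reduce
  rw [nullDistD_comm d τ y x, hxy, ENNReal.toReal_ofReal (abs_nonneg _)]
  rcases le_total (τ x) (τ y) with hle | hle
  · exact Or.inr (abs_of_nonneg (sub_nonneg.2 hle)).symm
  · exact Or.inl (by rw [abs_sub_comm, abs_of_nonneg (sub_nonneg.2 hle)])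

theorem nullDistD_toReal_nullDistD {X : Type*} {d : X → X → ℝ} {τ : X → ℝ}
    (hfin : ∀ x y, nullDistD d τ x y ≠ ⊤) (x y : X) :
    nullDistD (fun x y => (nullDistD d τ x y).toReal) τ x y = nullDistD d τ x y := by
  apply le_antisymm
  · have := le_nullDistD_add (d := d) (τ := τ)
      (fun w => nullDistD (fun x y => (nullDistD d τ x y).toReal) τ w y)
      (fun a b h => nullDistD_le_add_of_causallyRelatedD h.toReal_nullDistD y) x y
    simpa [nullDistD_self] using this
  · have := le_nullDistD_add (d := fun x y => (nullDistD d τ x y).toReal) (τ := τ)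
      (fun w => nullDistD d τ w y) (fun a b h => ?_) x y
    · simpa [nullDistD_self] using this
    · refine (nullDistD_triangle d τ a b y).trans (add_le_add_left ?_ _)
      exact ENNReal.le_ofReal_iff_toReal_le (hfin a b) (abs_nonneg _) |>.2
        (h.le_abs_sub fun x y => by rw [nullDistD_comm])

/-- If the null distance of a timed-metric space `(X, d, τ)` takes only finite values, then
`(X, d̂_{d,τ}, τ)` is a timed-metric space whose null distance is again `d̂_{d,τ}`;
in particular `(X, d̂_{d,τ}, τ)` is causally null. -/
theorem nullDist_idempotent {X : Type*} [MetricSpace X]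
    (τ : X → ℝ) (hτ0 : ∀ x, 0 ≤ τ x) (hτ : LipschitzWith 1 τ)
    (hfin : ∀ p q, nullDistD dist τ p q ≠ ⊤) :
    (∀ p q, (nullDistD dist τ p q).toReal = (nullDistD dist τ q p).toReal) ∧
    (∀ p q, (nullDistD dist τ p q).toReal = 0 ↔ p = q) ∧
    (∀ p q r, (nullDistD dist τ p r).toReal ≤
      (nullDistD dist τ p q).toReal + (nullDistD dist τ q r).toReal) ∧
    (∀ p q, |τ p - τ q| ≤ (nullDistD dist τ p q).toReal) ∧
    (∀ p q, nullDistD (fun x y => (nullDistD dist τ x y).toReal) τ p q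
      = nullDistD dist τ p q) ∧
    (∀ p q, nullDistD (fun x y => (nullDistD dist τ x y).toReal) τ p q
      = ENNReal.ofReal ((nullDistD dist τ p q).toReal)) := by
  have hidem := nullDistD_toReal_nullDistD hfin
  refine ⟨fun p q => by rw [nullDistD_comm], fun p q => ⟨fun h => ?_, ?_⟩, fun p q r => ?_,
    fun p q => ?_, hidem, fun p q => by rw [hidem, ENNReal.ofReal_toReal (hfin p q)]⟩
  · have h0 := ((ENNReal.toReal_eq_zero_iff _).1 h).resolve_right (hfin p q)
    exact edist_le_zero.1 (h0 ▸ edist_le_nullDistD τ p q)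
  · rintro rfl
    rw [nullDistD_self, ENNReal.toReal_zero]
  · rw [← ENNReal.toReal_add (hfin p q) (hfin q r)]
    exact ENNReal.toReal_mono (ENNReal.add_ne_top.2 ⟨hfin p q, hfin q r⟩)
      (nullDistD_triangle dist τ p q r)
  · exact (ENNReal.ofReal_le_iff_le_toReal (hfin p q)).1 (ofReal_abs_sub_le_nullDistD dist τ p q)
end

section
/- Let (X_j,d_j,τ_j), j ∈ ℕ, be a sequence of compact timed-metric spaces that is uniformly equibounded and equicompact, and such that there exists τ_max ≥ 0 with τ_j(X_j) ⊂ [0,τ_max] for all j. Then a subsequence converges in the timed-Gromov–Hausdorff sense to a compact timed-metric space (X_∞, d_∞, τ_∞). In fact, there exist a compact metric space Z and distance- and time-preserving maps φ_j = (τ_j, ξ_j) : X_j → [0,τ_max] × Z (into the max-product space), with ξ_j : X_j → Z distance preserving, for j in the subsequence and for j = ∞, such that d_H^{[0,τ_max]×Z}(φ_j(X_j), φ_∞(X_∞)) → 0. -/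
/-- A bundled compact metric space. -/
structure CompMS : Type 1 where
  carrier : Type
  [metric : MetricSpace carrier]
  [compact : CompactSpace carrier]

attribute [instance] CompMS.metric CompMS.compact

instance : CoeSort CompMS Type := ⟨CompMS.carrier⟩

/-- The set of values `d_H^{[0,τmax]×Z}(φ₁(X₁), φ₂(X₂))` over all compact metric spaces `Z`
and all time- and distance-preserving maps `φⱼ : Xⱼ → [0,τmax] × Z` into the max-product
space (the product metric is the `max`-metric, and `τ_prod` is the first coordinate), where
`τmax = max (sup τ₁) (sup τ₂)`. -/
def tauGHSet (X₁ X₂ : Type*) [MetricSpace X₁] [MetricSpace X₂]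
    (τ₁ : X₁ → ℝ) (τ₂ : X₂ → ℝ) : Set ℝ :=
  { r | ∃ (Z : CompMS)
      (φ₁ : X₁ → Set.Icc (0:ℝ) (max (⨆ x, τ₁ x) (⨆ x, τ₂ x)) × Z)
      (φ₂ : X₂ → Set.Icc (0:ℝ) (max (⨆ x, τ₁ x) (⨆ x, τ₂ x)) × Z),
      Isometry φ₁ ∧ Isometry φ₂ ∧
      (∀ x, ((φ₁ x).1 : ℝ) = τ₁ x) ∧ (∀ x, ((φ₂ x).1 : ℝ) = τ₂ x) ∧
      r = Metric.hausdorffDist (Set.range φ₁) (Set.range φ₂) }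

/-- The timed-Gromov–Hausdorff distance. -/
noncomputable def tauGHDist (X₁ X₂ : Type*) [MetricSpace X₁] [MetricSpace X₂]
    (τ₁ : X₁ → ℝ) (τ₂ : X₂ → ℝ) : ℝ :=
  sInf (tauGHSet X₁ X₂ τ₁ τ₂)

open Filter Topology

open Metric in
/-- A family of bounded metric spaces carrying densely ranged maps from a common index type that is
uniformly totally bounded for all of them embeds isometrically in a single compact metric space. -/
theorem exists_compMS_isometry {ι A : Type} (X : ι → CompMS) (D : ℝ)
    (hD : ∀ j (x y : X j), dist x y ≤ D) (p : ∀ j, A → X j) (hp : ∀ j, DenseRange (p j))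
    (hS : ∀ ε > 0, ∃ S : Finset A, ∀ a, ∃ s ∈ S, ∀ j, dist (p j a) (p j s) ≤ ε) :
    ∃ (Z : CompMS) (ξ : ∀ j, X j → Z), ∀ j, Isometry (ξ j) := by
  let _ : TopologicalSpace A := ⊥
  have _ : DiscreteTopology A := ⟨rfl⟩
  let f : ∀ j, X j → BoundedContinuousFunction A ℝ := fun j x =>
    BoundedContinuousFunction.ofNormedAddCommGroup (fun a => dist x (p j a))
      continuous_of_discreteTopology D
      (fun a => by rw [Real.norm_of_nonneg dist_nonneg]; exact hD _ _ _)
  have hfa : ∀ j x a, f j x a = dist x (p j a) := fun _ _ _ => rfl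
  have hf : ∀ j, Isometry (f j) := by
    refine fun j => Isometry.of_dist_eq fun x y => le_antisymm ?_ ?_
    · refine (BoundedContinuousFunction.dist_le dist_nonneg).2 fun a => ?_
      rw [hfa, hfa]
      exact dist_dist_dist_le_left _ _ _
    · refine le_of_forall_pos_le_add fun ε hε => ?_
      obtain ⟨a, ha⟩ := (hp j).exists_dist_lt x (half_pos hε)
      have h := BoundedContinuousFunction.dist_coe_le_dist (f := f j x) (g := f j y) a
      rw [hfa, hfa, Real.dist_eq] at h
      have h1 := (abs_le.1 h).1
      have h2 := dist_triangle_right x y (p j a)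
      linarith
  have htb : TotallyBounded (⋃ j, Set.range (f j)) := by
    refine totallyBounded_of_finite_discretization fun ε hε => ?_
    obtain ⟨S, hS⟩ := hS (ε / 5) (by positivity)
    have hK : TotallyBounded (Set.Icc (0 : S → ℝ) (fun _ => D)) := isCompact_Icc.totallyBounded
    obtain ⟨T, hT, hcov⟩ := totallyBounded_iff.1 hK (ε / 5) (by positivity)
    have key : ∀ u : (⋃ j, Set.range (f j) : Set _), ∃ t : T,
        ∀ s : S, dist (u.1 s) (t.1 s) < ε / 5 := by
      rintro ⟨u, hu⟩
      obtain ⟨j, x, rfl⟩ := Set.mem_iUnion.1 hu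
      have hmem : (fun s : S => f j x s) ∈ Set.Icc (0 : S → ℝ) (fun _ => D) :=
        ⟨fun s => dist_nonneg, fun s => hD _ _ _⟩
      obtain ⟨t, ht, htd⟩ := Set.mem_iUnion₂.1 (hcov hmem)
      exact ⟨⟨t, ht⟩, fun s => (dist_le_pi_dist (fun s : S => f j x s) t s).trans_lt htd⟩
    choose F hF using key
    have := hT.fintype
    refine ⟨T, this, F, ?_⟩
    rintro ⟨u, hu⟩ ⟨v, hv⟩ huv
    have hu' := hF ⟨u, hu⟩
    have hv' := hF ⟨v, hv⟩
    rw [← huv] at hv'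
    obtain ⟨i, x, rfl⟩ := Set.mem_iUnion.1 hu
    obtain ⟨j, y, rfl⟩ := Set.mem_iUnion.1 hv
    refine lt_of_le_of_lt ((BoundedContinuousFunction.dist_le (C := 4 * (ε / 5))
      (by positivity)).2 fun a => ?_) (by linarith)
    obtain ⟨s, hs, hsa⟩ := hS a
    have h1 := hu' ⟨s, hs⟩
    have h2 := hv' ⟨s, hs⟩
    have h3 : dist (f i x a) (f i x s) ≤ ε / 5 := (dist_dist_dist_le_right _ _ _).trans (hsa i)
    have h4 : dist (f j y a) (f j y s) ≤ ε / 5 := (dist_dist_dist_le_right _ _ _).trans (hsa j)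
    simp only [Real.dist_eq, abs_lt, abs_le] at h1 h2 h3 h4 ⊢
    constructor <;> linarith
  have hc : IsCompact (closure (⋃ j, Set.range (f j))) :=
    htb.closure.isCompact_of_isClosed isClosed_closure
  have : CompactSpace (closure (⋃ j, Set.range (f j))) := isCompact_iff_compactSpace.1 hc
  exact ⟨⟨closure (⋃ j, Set.range (f j))⟩,
    fun j x => ⟨f j x, subset_closure (Set.mem_iUnion.2 ⟨j, x, rfl⟩)⟩, fun j => hf j⟩

/-- The point reached from `x₀` by following the steps `q k i`, where `k` counts the previous
steps and `i` is the next entry of the list. -/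
def stepPath {Y : Type*} (q : ℕ → ℕ → Y → Y) (x₀ : Y) : List ℕ → Y
  | [] => x₀
  | i :: l => q l.length i (stepPath q x₀ l)

/-- The lists of length `K` whose entry added at step `k` is at most `N k`. -/
def boundedLists (N : ℕ → ℕ) : ℕ → Finset (List ℕ)
  | 0 => {[]}
  | K + 1 => Finset.image₂ List.cons (Finset.range (N K + 1)) (boundedLists N K)

theorem length_of_mem_boundedLists (N : ℕ → ℕ) :
    ∀ (K : ℕ) (s : List ℕ), s ∈ boundedLists N K → s.length = K
  | 0, s, h => by simpa [boundedLists] using h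
  | K + 1, s, h => by
    obtain ⟨i, -, l, hl, rfl⟩ := Finset.mem_image₂.1 h
    simp [length_of_mem_boundedLists N K l hl]

theorem exists_boundedLists_stepPath_eq {ι : Type*} {Y : ι → Type*} (q : ∀ j, ℕ → ℕ → Y j → Y j)
    (x₀ : ∀ j, Y j) (N : ℕ → ℕ) (hq : ∀ j k i y, N k ≤ i → q j k i y = y) :
    ∀ (K : ℕ) (l : List ℕ), l.length ≤ K → ∃ s ∈ boundedLists N K,
      ∀ j, stepPath (q j) (x₀ j) l = stepPath (q j) (x₀ j) s
  | 0, l, hl => ⟨[], by simp [boundedLists], fun j => by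
      rw [List.eq_nil_of_length_eq_zero (Nat.le_zero.1 hl)]⟩
  | K + 1, l, hl => by
    rcases Nat.lt_or_ge K l.length with h | h
    · obtain _ | ⟨i, l⟩ := l
      · simp at h
      simp only [List.length_cons] at h hl
      have hlK : l.length = K := by omega
      obtain ⟨s, hs, hse⟩ := exists_boundedLists_stepPath_eq q x₀ N hq K l hlK.le
      have hsK := length_of_mem_boundedLists N K s hs
      refine ⟨min i (N K) :: s, Finset.mem_image₂.2 ⟨_, by simp, s, hs, rfl⟩, fun j => ?_⟩
      simp only [stepPath, hlK, hsK, hse]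
      rcases le_total i (N K) with hi | hi
      · rw [min_eq_left hi]
      · rw [min_eq_right hi, hq _ _ _ _ hi, hq _ _ _ _ le_rfl]
    · obtain ⟨s, hs, hse⟩ := exists_boundedLists_stepPath_eq q x₀ N hq K l h
      have hsK := length_of_mem_boundedLists N K s hs
      refine ⟨N K :: s, Finset.mem_image₂.2 ⟨_, by simp, s, hs, rfl⟩, fun j => ?_⟩
      simp only [stepPath, hsK, hse, hq _ _ _ _ le_rfl]

theorem exists_boundedLists_dist_stepPath_le {ι : Type*} {Y : ι → Type*} [∀ j, MetricSpace (Y j)]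
    (q : ∀ j, ℕ → ℕ → Y j → Y j) (x₀ : ∀ j, Y j) (N : ℕ → ℕ)
    (hq : ∀ j k i y, N k ≤ i → q j k i y = y) (D : ℝ)
    (hqd : ∀ j k i y, dist (q j k i y) y ≤ 2 * (D / 2 ^ k)) (K : ℕ) :
    ∀ l : List ℕ, K ≤ l.length → ∃ s ∈ boundedLists N K, ∀ j,
      dist (stepPath (q j) (x₀ j) l) (stepPath (q j) (x₀ j) s)
        ≤ 4 * (D / 2 ^ K) - 4 * (D / 2 ^ l.length)
  | [], hl => by
    obtain rfl : K = 0 := by simpa using hl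
    exact ⟨[], by simp [boundedLists], fun j => by simp⟩
  | i :: l, hl => by
    rcases hl.eq_or_lt with h | h
    · obtain ⟨s, hs, hse⟩ := exists_boundedLists_stepPath_eq q x₀ N hq K (i :: l) h.ge
      exact ⟨s, hs, fun j => by rw [hse, dist_self, ← h, sub_self]⟩
    · obtain ⟨s, hs, hse⟩ := exists_boundedLists_dist_stepPath_le q x₀ N hq D hqd K l
        (by simpa [Nat.lt_succ_iff] using h)
      refine ⟨s, hs, fun j => (dist_triangle _ (stepPath (q j) (x₀ j) l) _).trans ?_⟩
      have h1 := hqd j l.length i (stepPath (q j) (x₀ j) l)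
      have h2 := hse j
      have h3 : D / 2 ^ (i :: l).length = (D / 2 ^ l.length) / 2 := by
        rw [List.length_cons, pow_succ, div_div]
      rw [h3]
      simp only [stepPath]
      linarith

/-- An equibounded and equicompact family of nonempty compact metric spaces embeds isometrically in
a single compact metric space. -/
theorem exists_compMS_isometry_of_equicompact {ι : Type} (X : ι → CompMS)
    (hne : ∀ j, Nonempty (X j)) (D : ℝ) (hD : 0 < D) (hbdd : ∀ j (x y : X j), dist x y ≤ D)
    (hcpt : ∀ R : ℝ, 0 < R → R ≤ D → ∃ N : ℕ, ∀ j, ∃ c : Fin N → X j,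
      (Set.univ : Set (X j)) ⊆ ⋃ i, Metric.ball (c i) R) :
    ∃ (Z : CompMS) (ξ : ∀ j, X j → Z), ∀ j, Isometry (ξ j) := by
  classical
  have hr : ∀ k : ℕ, 0 < D / 2 ^ k := fun k => by positivity
  have hsucc : ∀ k : ℕ, D / 2 ^ (k + 1) = (D / 2 ^ k) / 2 := fun k => by rw [pow_succ, div_div]
  choose N c hc using fun k : ℕ => hcpt (D / 2 ^ (k + 1)) (hr _)
    (div_le_self hD.le (one_le_pow₀ one_le_two))
  let x₀ : ∀ j, X j := fun j => (hne j).some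
  let q : ∀ j, ℕ → ℕ → X j → X j := fun j k i y =>
    if h : i < N k then
      if dist (c k j ⟨i, h⟩) y ≤ 2 * (D / 2 ^ k) then c k j ⟨i, h⟩ else y
    else y
  have hq : ∀ j k i y, N k ≤ i → q j k i y = y := fun j k i y h => dif_neg h.not_gt
  have hqd : ∀ j k i y, dist (q j k i y) y ≤ 2 * (D / 2 ^ k) := by
    intro j k i y
    have := hr k
    simp only [q]
    split_ifs with h h'
    · exact h'
    · rw [dist_self]; positivity
    · rw [dist_self]; positivity
  have happrox : ∀ j (x : X j) (k : ℕ), ∃ l : List ℕ, l.length = k ∧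
      dist x (stepPath (q j) (x₀ j) l) ≤ D / 2 ^ k := by
    intro j x k
    induction k with
    | zero => exact ⟨[], rfl, by simpa using hbdd j _ _⟩
    | succ k ih =>
      obtain ⟨l, hl, hd⟩ := ih
      obtain ⟨i, hi⟩ := Set.mem_iUnion.1 (hc k j (Set.mem_univ x))
      rw [Metric.mem_ball] at hi
      refine ⟨i :: l, by simp [hl], ?_⟩
      have hnear : dist (c k j i) (stepPath (q j) (x₀ j) l) ≤ 2 * (D / 2 ^ k) := by
        have h1 := dist_triangle_left (c k j i) (stepPath (q j) (x₀ j) l) x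
        have h2 := hsucc k
        have h3 := hr k
        linarith
      have : stepPath (q j) (x₀ j) (↑i :: l) = c k j i := by
        simp only [stepPath, hl, q, i.2, dite_true, Fin.eta, hnear, if_true]
      rw [this]
      exact hi.le
  have hsmall : ∀ ε > 0, ∃ k : ℕ, D / 2 ^ k < ε := by
    intro ε hε
    obtain ⟨k, hk⟩ := pow_unbounded_of_one_lt (D / ε) (one_lt_two (α := ℝ))
    exact ⟨k, (div_lt_comm₀ (by positivity) hε).2 hk⟩
  refine exists_compMS_isometry X D hbdd (fun j => stepPath (q j) (x₀ j)) (fun j => ?_) ?_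
  · refine Metric.denseRange_iff.2 fun x ε hε => ?_
    obtain ⟨k, hk⟩ := hsmall ε hε
    obtain ⟨l, -, hl⟩ := happrox j x k
    exact ⟨l, hl.trans_lt hk⟩
  · intro ε hε
    obtain ⟨K, hK⟩ := hsmall (ε / 4) (by positivity)
    refine ⟨boundedLists N K, fun l => ?_⟩
    rcases le_total l.length K with h | h
    · obtain ⟨s, hs, hse⟩ := exists_boundedLists_stepPath_eq q x₀ N hq K l h
      exact ⟨s, hs, fun j => by rw [hse, dist_self]; exact hε.le⟩
    · obtain ⟨s, hs, hse⟩ := exists_boundedLists_dist_stepPath_le q x₀ N hq D hqd K l h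
      refine ⟨s, hs, fun j => (hse j).trans ?_⟩
      have := hr l.length
      linarith

theorem isometry_prodMk_Icc {Y Z : Type*} [MetricSpace Y] [MetricSpace Z] {a b : ℝ} {t : Y → ℝ}
    (ht : LipschitzWith 1 t) (hmem : ∀ y, t y ∈ Set.Icc a b) {ξ : Y → Z} (hξ : Isometry ξ) :
    Isometry (fun y => ((⟨t y, hmem y⟩, ξ y) : Set.Icc a b × Z)) := by
  refine Isometry.of_dist_eq fun x y => ?_
  rw [Prod.dist_eq, Subtype.dist_eq, hξ.dist_eq]
  exact max_eq_right (by simpa using ht.dist_le_mul x y)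

theorem tauGHDist_nonneg (X₁ X₂ : Type*) [MetricSpace X₁] [MetricSpace X₂]
    (τ₁ : X₁ → ℝ) (τ₂ : X₂ → ℝ) : 0 ≤ tauGHDist X₁ X₂ τ₁ τ₂ := by
  refine Real.sInf_nonneg ?_
  rintro r ⟨Z, φ₁, φ₂, -, -, -, -, rfl⟩
  exact Metric.hausdorffDist_nonneg

/-- Isometric embeddings in a product with any interval containing all times bound the
timed-Gromov–Hausdorff distance. -/
theorem tauGHDist_le_hausdorffDist {X₁ X₂ : Type*} [MetricSpace X₁] [MetricSpace X₂]
    {τ₁ : X₁ → ℝ} {τ₂ : X₂ → ℝ} (h₁ : LipschitzWith 1 τ₁) (h₂ : LipschitzWith 1 τ₂) {b : ℝ}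
    (hb₁ : ∀ x, τ₁ x ∈ Set.Icc 0 b) (hb₂ : ∀ x, τ₂ x ∈ Set.Icc 0 b) (Z : CompMS)
    {ξ₁ : X₁ → Z} {ξ₂ : X₂ → Z} (hξ₁ : Isometry ξ₁) (hξ₂ : Isometry ξ₂) :
    tauGHDist X₁ X₂ τ₁ τ₂ ≤ Metric.hausdorffDist
      (Set.range fun x => ((⟨τ₁ x, hb₁ x⟩, ξ₁ x) : Set.Icc 0 b × Z))
      (Set.range fun x => ((⟨τ₂ x, hb₂ x⟩, ξ₂ x) : Set.Icc 0 b × Z)) := by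
  have hm₁ : ∀ x, τ₁ x ∈ Set.Icc 0 (max (⨆ x, τ₁ x) (⨆ x, τ₂ x)) := fun x =>
    ⟨(hb₁ x).1, (le_ciSup ⟨b, by rintro _ ⟨y, rfl⟩; exact (hb₁ y).2⟩ x).trans (le_max_left _ _)⟩
  have hm₂ : ∀ x, τ₂ x ∈ Set.Icc 0 (max (⨆ x, τ₁ x) (⨆ x, τ₂ x)) := fun x =>
    ⟨(hb₂ x).1, (le_ciSup ⟨b, by rintro _ ⟨y, rfl⟩; exact (hb₂ y).2⟩ x).trans (le_max_right _ _)⟩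
  refine csInf_le ⟨0, ?_⟩ ⟨Z, _, _, isometry_prodMk_Icc h₁ hm₁ hξ₁, isometry_prodMk_Icc h₂ hm₂ hξ₂,
    fun _ => rfl, fun _ => rfl, ?_⟩
  · rintro r ⟨Z, φ₁, φ₂, -, -, -, -, rfl⟩
    exact Metric.hausdorffDist_nonneg
  · have hiso : ∀ c : ℝ, Isometry (fun w : Set.Icc (0 : ℝ) c × Z => ((w.1 : ℝ), w.2)) :=
      fun c => isometry_subtype_coe.prodMap isometry_id
    rw [← Metric.hausdorffDist_image (hiso b), ← Metric.hausdorffDist_image (hiso (max _ _))]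
    simp only [← Set.range_comp, Function.comp_def]

/-- Inequalities between continuous functions of two points pass to limits of sets
in the Hausdorff distance. -/
theorem le_of_tendsto_nonemptyCompacts {W : Type*} [MetricSpace W]
    {K : ℕ → TopologicalSpace.NonemptyCompacts W} {L : TopologicalSpace.NonemptyCompacts W}
    (hKL : Tendsto K atTop (𝓝 L)) {F : W → W → ℝ} (hF : Continuous fun w : W × W => F w.1 w.2)
    (h : ∀ k, ∀ u ∈ K k, ∀ v ∈ K k, F u v ≤ 0) : ∀ u ∈ L, ∀ v ∈ L, F u v ≤ 0 := by
  have hd : Tendsto (fun k => dist (K k) L) atTop (𝓝 0) := tendsto_iff_dist_tendsto_zero.1 hKL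
  have approx : ∀ u ∈ L, ∃ s : ℕ → W, (∀ k, s k ∈ K k) ∧ Tendsto s atTop (𝓝 u) := by
    intro u hu
    have hex : ∀ k, ∃ w ∈ K k, dist w u ≤ dist (K k) L := by
      intro k
      obtain ⟨w, hw, hwd⟩ := (K k).isCompact.exists_infDist_eq_dist (K k).nonempty u
      refine ⟨w, hw, ?_⟩
      rw [dist_comm, ← hwd, dist_comm, Metric.NonemptyCompacts.dist_eq]
      exact Metric.infDist_le_hausdorffDist_of_mem hu
        (Metric.hausdorffEDist_ne_top_of_nonempty_of_bounded L.nonempty (K k).nonempty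
          L.isCompact.isBounded (K k).isCompact.isBounded)
    choose s hs hsd using hex
    exact ⟨s, hs, tendsto_iff_dist_tendsto_zero.2
      (squeeze_zero (fun _ => dist_nonneg) hsd hd)⟩
  intro u hu v hv
  obtain ⟨s, hs, hsu⟩ := approx u hu
  obtain ⟨t, ht, htv⟩ := approx v hv
  exact le_of_tendsto' ((hF.tendsto (u, v)).comp (hsu.prodMk_nhds htv))
    fun k => h k _ (hs k) _ (ht k)

/-- Compactness theorem for the timed-Gromov–Hausdorff distance: an equibounded,
equicompact sequence of compact timed-metric spaces with uniformly bounded time functions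
has a subsequence converging in the timed-Gromov–Hausdorff sense to a compact timed-metric
space `(Xinf, d∞, τinf)`; in fact there are a compact metric space `Z` and distance- and
time-preserving maps `φⱼ = (τⱼ, ξⱼ) : Xⱼ → [0,τmax] × Z`, with `ξⱼ` distance preserving,
such that the Hausdorff distances between the images converge to zero. -/
theorem tauGH_compactness (X : ℕ → CompMS) (hne : ∀ j, Nonempty (X j))
    (τ : ∀ j, X j → ℝ) (hτ0 : ∀ j x, 0 ≤ τ j x) (hτlip : ∀ j, LipschitzWith 1 (τ j))
    (D : ℝ) (hD : 0 < D)
    (hbdd : ∀ j, Metric.diam (Set.univ : Set (X j)) ≤ D)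
    (hcpt : ∀ R : ℝ, 0 < R → R ≤ D → ∃ N : ℕ, ∀ j, ∃ c : Fin N → X j,
      (Set.univ : Set (X j)) ⊆ ⋃ i, Metric.ball (c i) R)
    (τmax : ℝ) (hτmax : 0 ≤ τmax) (hτbdd : ∀ j, ∀ x, τ j x ∈ Set.Icc 0 τmax) :
    ∃ (Xinf : CompMS) (τinf : Xinf → ℝ), (∀ x, 0 ≤ τinf x) ∧ LipschitzWith 1 τinf ∧
      ∃ g : ℕ → ℕ, StrictMono g ∧
        Tendsto (fun k => tauGHDist (X (g k)) Xinf (τ (g k)) τinf) atTop (𝓝 0) ∧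
        ∃ (Z : CompMS) (φ : ∀ k, X (g k) → Set.Icc (0:ℝ) τmax × Z)
          (φinf : Xinf → Set.Icc (0:ℝ) τmax × Z),
          (∀ k, Isometry (φ k)) ∧ (∀ k, ∀ x, ((φ k x).1 : ℝ) = τ (g k) x) ∧
          (∀ k, Isometry (fun x => (φ k x).2)) ∧
          Isometry φinf ∧ (∀ x, ((φinf x).1 : ℝ) = τinf x) ∧
          Isometry (fun x => (φinf x).2) ∧
          Tendsto (fun k => Metric.hausdorffDist (Set.range (φ k)) (Set.range φinf))
            atTop (𝓝 0) := by
  have hdist : ∀ j (x y : X j), dist x y ≤ D := fun j x y =>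
    (Metric.dist_le_diam_of_mem isCompact_univ.isBounded (Set.mem_univ x) (Set.mem_univ y)).trans
      (hbdd j)
  obtain ⟨Z, ξ, hξ⟩ := exists_compMS_isometry_of_equicompact X hne D hD hdist hcpt
  let φ : ∀ j, X j → Set.Icc (0:ℝ) τmax × Z := fun j x => (⟨τ j x, hτbdd j x⟩, ξ j x)
  have hφ : ∀ j, Isometry (φ j) := fun j => isometry_prodMk_Icc (hτlip j) (hτbdd j) (hξ j)
  let K : ℕ → TopologicalSpace.NonemptyCompacts (Set.Icc (0:ℝ) τmax × Z) := fun j =>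
    ⟨⟨Set.range (φ j), isCompact_range (hφ j).continuous⟩, Set.range_nonempty _⟩
  obtain ⟨L, g, hg, hgL⟩ := CompactSpace.tendsto_subseq K
  have hcausal : ∀ u ∈ L, ∀ v ∈ L, dist u.1 v.1 - dist u.2 v.2 ≤ 0 := by
    refine le_of_tendsto_nonemptyCompacts hgL
      (F := fun u v => dist u.1 v.1 - dist u.2 v.2) (by fun_prop) ?_
    rintro k _ ⟨x, rfl⟩ _ ⟨y, rfl⟩
    rw [sub_nonpos, (hξ _).dist_eq]
    simpa [φ, Subtype.dist_eq] using (hτlip (g k)).dist_le_mul x y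
  have : CompactSpace L := isCompact_iff_compactSpace.1 L.isCompact
  have hsnd : Isometry (fun x : L => x.1.2) := Isometry.of_dist_eq fun x y => by
    rw [Subtype.dist_eq, Prod.dist_eq]
    exact (max_eq_right (sub_nonpos.1 (hcausal x x.2 y y.2))).symm
  have htime : LipschitzWith 1 (fun x : L => (x.1.1 : ℝ)) := LipschitzWith.of_dist_le_mul
    fun x y => by
      rw [NNReal.coe_one, one_mul, Subtype.dist_eq x y, Prod.dist_eq]
      exact le_max_left _ _
  have hlim : Tendsto (fun k => Metric.hausdorffDist (Set.range (φ (g k)))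
      (Set.range (Subtype.val : L → Set.Icc (0:ℝ) τmax × Z))) atTop (𝓝 0) := by
    rw [Subtype.range_val]
    exact tendsto_iff_dist_tendsto_zero.1 hgL
  refine ⟨⟨L⟩, fun x => x.1.1, fun x => x.1.1.2.1, htime, g, hg, ?_, Z, fun k => φ (g k),
    Subtype.val, fun k => hφ _, fun _ _ => rfl, fun k => hξ _, isometry_subtype_coe,
    fun _ => rfl, hsnd, hlim⟩
  exact squeeze_zero (fun _ => tauGHDist_nonneg _ _ _ _)
    (fun k => tauGHDist_le_hausdorffDist (hτlip (g k)) htime (hτbdd (g k))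
      (fun x => x.1.1.2) Z (hξ (g k)) hsnd) hlim
end
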